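/- Let F be a polarized rigid graphing function (analytic near the origin of ℂ², holomorphic in each variable, satisfying the reality condition) with F(0,0) = 0 and with ∂_z∂_w F nonvanishing near the origin (Levi nondegeneracy). Then the following are equivalent: (a) F_{zzww}·F_{zw} − F_{zzw}·F_{zww} ≡ 0 identically near the origin; (b) the hypersurface {u = F} is rigidly biholomorphically equivalent to the Heisenberg sphere {u' = z'·z̄'}, i.e. there exist ρ ∈ ℝ\{0} and holomorphic functions f, g near 0 ∈ ℂ with f(0) = 0 and f'(0) ≠ 0 such that ρ·F(z,w) + (1/2)g(z) + (1/2)ḡ(w) = f(z)·f̄(w) for all (z,w) near (0,0). -/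

import Mathlib

open Complex Filter Topology ComplexConjugate

/-- Partial derivative in the first (`z`) slot. -/
noncomputable def pd1 (F : ℂ → ℂ → ℂ) : ℂ → ℂ → ℂ := fun z w => deriv (fun t => F t w) z

/-- Partial derivative in the second (`w`) slot. -/
noncomputable def pd2 (F : ℂ → ℂ → ℂ) : ℂ → ℂ → ℂ := fun z w => deriv (fun t => F z t) w

/-- Polarized rigid graphing function: analytic near the origin of `ℂ²` (hence holomorphic
in each of the two variables), and satisfying the reality condition near the origin. -/
def IsPolarizedRigid (F : ℂ → ℂ → ℂ) : Prop :=
  AnalyticAt ℂ (fun p : ℂ × ℂ => F p.1 p.2) 0 ∧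
    ∀ᶠ p : ℂ × ℂ in 𝓝 0, F p.1 p.2 = conj (F (conj p.2) (conj p.1))


section PolarizedPartials

variable {F : ℂ → ℂ → ℂ} {z w : ℂ}

lemma differentiableAt_slot1 (h : AnalyticAt ℂ (fun p : ℂ × ℂ => F p.1 p.2) (z, w)) :
    DifferentiableAt ℂ (fun t => F t w) z :=
  h.differentiableAt.comp (f := fun t : ℂ => (t, w)) z (by fun_prop)

lemma differentiableAt_slot2 (h : AnalyticAt ℂ (fun p : ℂ × ℂ => F p.1 p.2) (z, w)) :
    DifferentiableAt ℂ (fun t => F z t) w :=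
  h.differentiableAt.comp (f := fun t : ℂ => (z, t)) w (by fun_prop)

lemma pd1_eq_fderiv (h : AnalyticAt ℂ (fun p : ℂ × ℂ => F p.1 p.2) (z, w)) :
    pd1 F z w = fderiv ℂ (fun p : ℂ × ℂ => F p.1 p.2) (z, w) (1, 0) :=
  (h.differentiableAt.hasFDerivAt.comp_hasDerivAt (f := fun t : ℂ => (t, w)) z
    ((hasDerivAt_id z).prodMk (hasDerivAt_const z w))).deriv

lemma pd2_eq_fderiv (h : AnalyticAt ℂ (fun p : ℂ × ℂ => F p.1 p.2) (z, w)) :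
    pd2 F z w = fderiv ℂ (fun p : ℂ × ℂ => F p.1 p.2) (z, w) (0, 1) :=
  (h.differentiableAt.hasFDerivAt.comp_hasDerivAt (f := fun t : ℂ => (z, t)) w
    ((hasDerivAt_const w z).prodMk (hasDerivAt_id w))).deriv

lemma pd1_eventuallyEq_fderiv (h : AnalyticAt ℂ (fun p : ℂ × ℂ => F p.1 p.2) (z, w)) :
    (fun p : ℂ × ℂ => pd1 F p.1 p.2) =ᶠ[𝓝 (z, w)]
      fun p => fderiv ℂ (fun p : ℂ × ℂ => F p.1 p.2) p (1, 0) :=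
  h.eventually_analyticAt.mono fun _ hp => pd1_eq_fderiv hp

lemma pd2_eventuallyEq_fderiv (h : AnalyticAt ℂ (fun p : ℂ × ℂ => F p.1 p.2) (z, w)) :
    (fun p : ℂ × ℂ => pd2 F p.1 p.2) =ᶠ[𝓝 (z, w)]
      fun p => fderiv ℂ (fun p : ℂ × ℂ => F p.1 p.2) p (0, 1) :=
  h.eventually_analyticAt.mono fun _ hp => pd2_eq_fderiv hp

lemma analyticAt_pd1 (h : AnalyticAt ℂ (fun p : ℂ × ℂ => F p.1 p.2) (z, w)) :
    AnalyticAt ℂ (fun p : ℂ × ℂ => pd1 F p.1 p.2) (z, w) :=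
  (((ContinuousLinearMap.apply ℂ ℂ ((1, 0) : ℂ × ℂ)).analyticAt _).comp h.fderiv).congr
    (pd1_eventuallyEq_fderiv h).symm

lemma analyticAt_pd2 (h : AnalyticAt ℂ (fun p : ℂ × ℂ => F p.1 p.2) (z, w)) :
    AnalyticAt ℂ (fun p : ℂ × ℂ => pd2 F p.1 p.2) (z, w) :=
  (((ContinuousLinearMap.apply ℂ ℂ ((0, 1) : ℂ × ℂ)).analyticAt _).comp h.fderiv).congr
    (pd2_eventuallyEq_fderiv h).symm

/-- Partial derivatives of an analytic function commute. -/
lemma pd2_pd1_comm (h : AnalyticAt ℂ (fun p : ℂ × ℂ => F p.1 p.2) (z, w)) :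
    pd2 (pd1 F) z w = pd1 (pd2 F) z w := by
  rw [pd2_eq_fderiv (analyticAt_pd1 h), pd1_eq_fderiv (analyticAt_pd2 h),
    (pd1_eventuallyEq_fderiv h).fderiv_eq, (pd2_eventuallyEq_fderiv h).fderiv_eq,
    fderiv_clm_apply h.fderiv.differentiableAt (by fun_prop),
    fderiv_clm_apply h.fderiv.differentiableAt (by fun_prop)]
  simpa using (h.contDiffAt (n := ⊤)).isSymmSndFDerivAt_of_omega.eq (0, 1) (1, 0)

variable {f h a b : ℂ → ℂ}

/-- The second-slot derivative of `f(z)h(w) + a(z) + b(w)`. -/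
lemma pd2_eventuallyEq_of_separated (hh : AnalyticAt ℂ h 0) (hb : AnalyticAt ℂ b 0)
    (hF : ∀ᶠ p : ℂ × ℂ in 𝓝 0, F p.1 p.2 = f p.1 * h p.2 + a p.1 + b p.2) :
    ∀ᶠ p : ℂ × ℂ in 𝓝 0, pd2 F p.1 p.2 = f p.1 * deriv h p.2 + 0 + deriv b p.2 := by
  have h2 : Tendsto (Prod.snd : ℂ × ℂ → ℂ) (𝓝 0) (𝓝 0) := continuous_snd.tendsto' _ _ rfl
  filter_upwards [hF.eventually_nhds, h2.eventually hh.eventually_analyticAt,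
    h2.eventually hb.eventually_analyticAt] with p hp hh' hb'
  have hc : Tendsto (fun t : ℂ => (p.1, t)) (𝓝 p.2) (𝓝 p) := by
    exact (by fun_prop : Continuous fun t : ℂ => (p.1, t)).tendsto' _ _ rfl
  have he : (fun t => F p.1 t) =ᶠ[𝓝 p.2] fun t => f p.1 * h t + a p.1 + b t :=
    hc.eventually hp
  rw [pd2, he.deriv_eq]
  exact (((hh'.differentiableAt.hasDerivAt.const_mul (f p.1)).add
    (hasDerivAt_const p.2 (a p.1))).add hb'.differentiableAt.hasDerivAt).deriv

/-- The first-slot derivative of `f(z)h(w) + a(z) + b(w)`. -/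
lemma pd1_eventuallyEq_of_separated (hf : AnalyticAt ℂ f 0) (ha : AnalyticAt ℂ a 0)
    (hF : ∀ᶠ p : ℂ × ℂ in 𝓝 0, F p.1 p.2 = f p.1 * h p.2 + a p.1 + b p.2) :
    ∀ᶠ p : ℂ × ℂ in 𝓝 0, pd1 F p.1 p.2 = deriv f p.1 * h p.2 + deriv a p.1 + 0 := by
  have h1 : Tendsto (Prod.fst : ℂ × ℂ → ℂ) (𝓝 0) (𝓝 0) := continuous_fst.tendsto' _ _ rfl
  filter_upwards [hF.eventually_nhds, h1.eventually hf.eventually_analyticAt,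
    h1.eventually ha.eventually_analyticAt] with p hp hf' ha'
  have hc : Tendsto (fun t : ℂ => (t, p.2)) (𝓝 p.1) (𝓝 p) := by
    exact (by fun_prop : Continuous fun t : ℂ => (t, p.2)).tendsto' _ _ rfl
  have he : (fun t => F t p.2) =ᶠ[𝓝 p.1] fun t => f t * h p.2 + a t + b p.2 :=
    hc.eventually hp
  rw [pd1, he.deriv_eq]
  exact (((hf'.differentiableAt.hasDerivAt.mul_const (h p.2)).add
    ha'.differentiableAt.hasDerivAt).add (hasDerivAt_const p.1 (b p.2))).deriv

/-- The invariant vanishes for `F(z, w) = f(z)h(w) + a(z) + b(w)`. -/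
lemma invariant_eq_zero_of_separated (hf : AnalyticAt ℂ f 0) (hh : AnalyticAt ℂ h 0)
    (hb : AnalyticAt ℂ b 0)
    (hF : ∀ᶠ p : ℂ × ℂ in 𝓝 0, F p.1 p.2 = f p.1 * h p.2 + a p.1 + b p.2) :
    ∀ᶠ p : ℂ × ℂ in 𝓝 0,
      pd1 (pd1 (pd2 (pd2 F))) p.1 p.2 * pd1 (pd2 F) p.1 p.2 -
        pd1 (pd1 (pd2 F)) p.1 p.2 * pd1 (pd2 (pd2 F)) p.1 p.2 = 0 := by
  have h0 : AnalyticAt ℂ (fun _ : ℂ => (0 : ℂ)) 0 := analyticAt_const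
  have e2 := pd2_eventuallyEq_of_separated hh hb hF
  have e12 := pd1_eventuallyEq_of_separated (a := fun _ => 0) hf h0 e2
  have e112 := pd1_eventuallyEq_of_separated (a := deriv fun _ => 0) (b := fun _ => 0)
    hf.deriv h0.deriv e12
  have e22 := pd2_eventuallyEq_of_separated (a := fun _ => 0) hh.deriv hb.deriv e2
  have e122 := pd1_eventuallyEq_of_separated (a := fun _ => 0) hf h0 e22
  have e1122 := pd1_eventuallyEq_of_separated (a := deriv fun _ => 0) (b := fun _ => 0)
    hf.deriv h0.deriv e122
  filter_upwards [e12, e112, e122, e1122] with p h1 h2 h3 h4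
  rw [h1, h2, h3, h4]
  simp only [deriv_const', add_zero]
  ring

variable {r : ℝ}

lemma eq_of_deriv_eq_zero_on_ball (hd : ∀ z ∈ Metric.ball (0 : ℂ) r, DifferentiableAt ℂ f z)
    (h0 : ∀ z ∈ Metric.ball (0 : ℂ) r, deriv f z = 0) (hz : z ∈ Metric.ball (0 : ℂ) r) :
    f z = f 0 :=
  Metric.isOpen_ball.is_const_of_deriv_eq_zero (convex_ball (0 : ℂ) r).isPreconnected
    (fun x hx => (hd x hx).differentiableWithinAt) h0 hz
    (Metric.mem_ball_self (Metric.pos_of_mem_ball hz))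

/-- A function on a bidisc with vanishing mixed derivative splits as a sum. -/
lemma eq_add_of_mixed_eq_zero
    (hF : ∀ z ∈ Metric.ball (0 : ℂ) r, ∀ w ∈ Metric.ball (0 : ℂ) r,
      AnalyticAt ℂ (fun p : ℂ × ℂ => F p.1 p.2) (z, w))
    (h0 : ∀ z ∈ Metric.ball (0 : ℂ) r, ∀ w ∈ Metric.ball (0 : ℂ) r, pd1 (pd2 F) z w = 0)
    (hz : z ∈ Metric.ball (0 : ℂ) r) (hw : w ∈ Metric.ball (0 : ℂ) r) :
    F z w = F z 0 + F 0 w - F 0 0 := by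
  have hr := Metric.mem_ball_self (x := (0 : ℂ)) (Metric.pos_of_mem_ball hz)
  have h2 : ∀ t ∈ Metric.ball (0 : ℂ) r, pd2 F z t = pd2 F 0 t := fun t ht =>
    eq_of_deriv_eq_zero_on_ball (f := fun s => pd2 F s t)
      (fun s hs => differentiableAt_slot1 (analyticAt_pd2 (hF s hs t ht)))
      (fun s hs => h0 s hs t ht) hz
  have h3 : F z w - F 0 w = F z 0 - F 0 0 :=
    eq_of_deriv_eq_zero_on_ball (f := fun t => F z t - F 0 t)
      (fun t ht => (differentiableAt_slot2 (hF z hz t ht)).sub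
        (differentiableAt_slot2 (hF 0 hr t ht)))
      (fun t ht => by
        rw [deriv_fun_sub (differentiableAt_slot2 (hF z hz t ht))
          (differentiableAt_slot2 (hF 0 hr t ht))]
        exact sub_eq_zero.2 (h2 t ht)) hw
  linear_combination h3

/-- A nonvanishing function on a bidisc whose logarithm has vanishing mixed derivative splits
as a product. -/
lemma mul_eq_mul_of_log_mixed_eq_zero
    (hF : ∀ z ∈ Metric.ball (0 : ℂ) r, ∀ w ∈ Metric.ball (0 : ℂ) r,
      AnalyticAt ℂ (fun p : ℂ × ℂ => F p.1 p.2) (z, w))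
    (hne : ∀ z ∈ Metric.ball (0 : ℂ) r, ∀ w ∈ Metric.ball (0 : ℂ) r, F z w ≠ 0)
    (h0 : ∀ z ∈ Metric.ball (0 : ℂ) r, ∀ w ∈ Metric.ball (0 : ℂ) r,
      pd2 (pd1 F) z w * F z w - pd1 F z w * pd2 F z w = 0)
    (hz : z ∈ Metric.ball (0 : ℂ) r) (hw : w ∈ Metric.ball (0 : ℂ) r) :
    F z w * F 0 0 = F z 0 * F 0 w := by
  have hr := Metric.mem_ball_self (x := (0 : ℂ)) (Metric.pos_of_mem_ball hz)
  have h2 : ∀ s ∈ Metric.ball (0 : ℂ) r, pd1 F s w / F s w = pd1 F s 0 / F s 0 := fun s hs =>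
    eq_of_deriv_eq_zero_on_ball (f := fun t => pd1 F s t / F s t)
      (fun t ht => (differentiableAt_slot2 (analyticAt_pd1 (hF s hs t ht))).div
        (differentiableAt_slot2 (hF s hs t ht)) (hne s hs t ht))
      (fun t ht => by
        rw [deriv_fun_div (differentiableAt_slot2 (analyticAt_pd1 (hF s hs t ht)))
          (differentiableAt_slot2 (hF s hs t ht)) (hne s hs t ht)]
        exact div_eq_zero_iff.2 (Or.inl (h0 s hs t ht))) hw
  have h3 : F z w / F z 0 = F 0 w / F 0 0 :=
    eq_of_deriv_eq_zero_on_ball (f := fun s => F s w / F s 0)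
      (fun s hs => (differentiableAt_slot1 (hF s hs w hw)).div
        (differentiableAt_slot1 (hF s hs 0 hr)) (hne s hs 0 hr))
      (fun s hs => by
        rw [deriv_fun_div (differentiableAt_slot1 (hF s hs w hw))
          (differentiableAt_slot1 (hF s hs 0 hr)) (hne s hs 0 hr)]
        have h4 := h2 s hs
        rw [div_eq_div_iff (hne s hs w hw) (hne s hs 0 hr)] at h4
        refine div_eq_zero_iff.2 (Or.inl ?_)
        change pd1 F s w * F s 0 - F s w * pd1 F s 0 = 0
        linear_combination h4) hz
  rw [div_eq_div_iff (hne z hz 0 hr) (hne 0 hr 0 hr)] at h3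
  linear_combination h3

/-- If the logarithm of the nonvanishing Levi form `F_{zw}` has vanishing mixed derivative on a
bidisc, then `F` is separated there. -/
lemma separated_of_log_levi_mixed_eq_zero
    (hF : ∀ z ∈ Metric.ball (0 : ℂ) r, ∀ w ∈ Metric.ball (0 : ℂ) r,
      AnalyticAt ℂ (fun p : ℂ × ℂ => F p.1 p.2) (z, w))
    (hne : ∀ z ∈ Metric.ball (0 : ℂ) r, ∀ w ∈ Metric.ball (0 : ℂ) r, pd1 (pd2 F) z w ≠ 0)
    (h0 : ∀ z ∈ Metric.ball (0 : ℂ) r, ∀ w ∈ Metric.ball (0 : ℂ) r,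
      pd1 (pd1 (pd2 (pd2 F))) z w * pd1 (pd2 F) z w -
        pd1 (pd1 (pd2 F)) z w * pd1 (pd2 (pd2 F)) z w = 0)
    (hz : z ∈ Metric.ball (0 : ℂ) r) (hw : w ∈ Metric.ball (0 : ℂ) r) :
    pd1 (pd2 F) 0 0 * (F z w - F z 0 - F 0 w + F 0 0) =
      (pd2 F z 0 - pd2 F 0 0) * (pd1 F 0 w - pd1 F 0 0) := by
  have hr := Metric.mem_ball_self (x := (0 : ℂ)) (Metric.pos_of_mem_ball hz)
  have hcomm : ∀ z ∈ Metric.ball (0 : ℂ) r, ∀ w ∈ Metric.ball (0 : ℂ) r,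
      pd2 (pd1 (pd2 F)) z w = pd1 (pd2 (pd2 F)) z w := fun z hz w hw =>
    pd2_pd1_comm (analyticAt_pd2 (hF z hz w hw))
  have hcomm' : ∀ z ∈ Metric.ball (0 : ℂ) r, ∀ w ∈ Metric.ball (0 : ℂ) r,
      pd2 (pd1 (pd1 (pd2 F))) z w = pd1 (pd1 (pd2 (pd2 F))) z w := by
    intro z hz w hw
    rw [pd2_pd1_comm (analyticAt_pd1 (analyticAt_pd2 (hF z hz w hw)))]
    refine Filter.EventuallyEq.deriv_eq ?_
    filter_upwards [Metric.isOpen_ball.mem_nhds hz] with s hs using hcomm s hs w hw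
  have hprod : ∀ z ∈ Metric.ball (0 : ℂ) r, ∀ w ∈ Metric.ball (0 : ℂ) r,
      pd1 (pd2 F) z w * pd1 (pd2 F) 0 0 = pd1 (pd2 F) z 0 * pd1 (pd2 F) 0 w :=
    fun z hz w hw => mul_eq_mul_of_log_mixed_eq_zero
      (fun z hz w hw => analyticAt_pd1 (analyticAt_pd2 (hF z hz w hw))) hne
      (fun z hz w hw => by rw [hcomm z hz w hw, hcomm' z hz w hw]; exact h0 z hz w hw) hz hw
  set c := pd1 (pd2 F) 0 0
  let G : ℂ → ℂ → ℂ := fun z w =>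
    c * F z w - (pd2 F z 0 - pd2 F 0 0) * (pd1 F 0 w - pd1 F 0 0)
  have hG : ∀ z ∈ Metric.ball (0 : ℂ) r, ∀ w ∈ Metric.ball (0 : ℂ) r,
      AnalyticAt ℂ (fun p : ℂ × ℂ => G p.1 p.2) (z, w) := by
    intro z hz w hw
    have h1 : AnalyticAt ℂ (fun p : ℂ × ℂ => pd2 F p.1 0) (z, w) :=
      (analyticAt_pd2 (hF z hz 0 hr)).comp_of_eq (f := fun p : ℂ × ℂ => (p.1, (0 : ℂ)))
        (analyticAt_fst.prod analyticAt_const) rfl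
    have h2 : AnalyticAt ℂ (fun p : ℂ × ℂ => pd1 F 0 p.2) (z, w) :=
      (analyticAt_pd1 (hF 0 hr w hw)).comp_of_eq (f := fun p : ℂ × ℂ => ((0 : ℂ), p.2))
        (analyticAt_const.prod analyticAt_snd) rfl
    exact (analyticAt_const.mul (hF z hz w hw)).sub
      ((h1.sub analyticAt_const).mul (h2.sub analyticAt_const))
  have hG2 : ∀ z ∈ Metric.ball (0 : ℂ) r, ∀ w ∈ Metric.ball (0 : ℂ) r,
      pd2 G z w = c * pd2 F z w - (pd2 F z 0 - pd2 F 0 0) * pd1 (pd2 F) 0 w := by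
    intro z hz w hw
    rw [← pd2_pd1_comm (hF 0 hr w hw)]
    exact (((differentiableAt_slot2 (hF z hz w hw)).hasDerivAt.const_mul c).sub
      (((differentiableAt_slot2 (analyticAt_pd1 (hF 0 hr w hw))).hasDerivAt.sub_const
        (pd1 F 0 0)).const_mul (pd2 F z 0 - pd2 F 0 0))).deriv
  have hG12 : ∀ z ∈ Metric.ball (0 : ℂ) r, ∀ w ∈ Metric.ball (0 : ℂ) r,
      pd1 (pd2 G) z w = 0 := by
    intro z hz w hw
    have he : (fun s => pd2 G s w) =ᶠ[𝓝 z]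
        fun s => c * pd2 F s w - (pd2 F s 0 - pd2 F 0 0) * pd1 (pd2 F) 0 w := by
      filter_upwards [Metric.isOpen_ball.mem_nhds hz] with s hs using hG2 s hs w hw
    have hd : pd1 (pd2 G) z w = c * pd1 (pd2 F) z w - pd1 (pd2 F) z 0 * pd1 (pd2 F) 0 w := by
      rw [pd1, he.deriv_eq]
      exact (((differentiableAt_slot1 (analyticAt_pd2 (hF z hz w hw))).hasDerivAt.const_mul
        c).sub (((differentiableAt_slot1 (analyticAt_pd2 (hF z hz 0 hr))).hasDerivAt.sub_const
        (pd2 F 0 0)).mul_const (pd1 (pd2 F) 0 w))).deriv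
    rw [hd]
    linear_combination hprod z hz w hw
  have := eq_add_of_mixed_eq_zero hG hG12 hz hw
  simp only [G] at this
  linear_combination this

end PolarizedPartials

/-- a Levi nondegenerate rigid hypersurface `{u = F}` in `ℂ²` is rigidly
biholomorphically equivalent to the Heisenberg sphere `{u' = z'z̄'}` if and only if
`F_{zzww}F_{zw} − F_{zzw}F_{zww} ≡ 0` near the origin. -/
theorem stmt3
    (F : ℂ → ℂ → ℂ) (hF : IsPolarizedRigid F) (hF0 : F 0 0 = 0)
    (hnd : ∀ᶠ p : ℂ × ℂ in 𝓝 0, pd1 (pd2 F) p.1 p.2 ≠ 0) :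
    (∀ᶠ p : ℂ × ℂ in 𝓝 0,
        pd1 (pd1 (pd2 (pd2 F))) p.1 p.2 * pd1 (pd2 F) p.1 p.2 -
            pd1 (pd1 (pd2 F)) p.1 p.2 * pd1 (pd2 (pd2 F)) p.1 p.2 = 0) ↔
      (∃ ρ : ℝ, ρ ≠ 0 ∧ ∃ f g : ℂ → ℂ,
        AnalyticAt ℂ f 0 ∧ AnalyticAt ℂ g 0 ∧ f 0 = 0 ∧ deriv f 0 ≠ 0 ∧
        ∀ᶠ p : ℂ × ℂ in 𝓝 0,
          (ρ : ℂ) * F p.1 p.2 + (1 / 2) * g p.1 + (1 / 2) * conj (g (conj p.2)) =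
            f p.1 * conj (f (conj p.2))) := by
  have hconj0 : Tendsto (fun z : ℂ => conj z) (𝓝 0) (𝓝 0) :=
    continuous_conj.tendsto' _ _ (map_zero _)
  have hconjA : ∀ {k : ℂ → ℂ}, AnalyticAt ℂ k 0 →
      AnalyticAt ℂ (fun w => conj (k (conj w))) 0 := by
    intro k hk
    rw [Complex.analyticAt_iff_eventually_differentiableAt] at hk ⊢
    filter_upwards [hconj0.eventually hk] with w hw
    exact differentiableAt_conj_conj_iff.2 hw
  constructor
  · intro h
    obtain ⟨r, hr, hball⟩ := Metric.eventually_nhds_iff_ball.1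
      (hF.1.eventually_analyticAt.and (hF.2.and (hnd.and h)))
    have hB : ∀ z ∈ Metric.ball (0 : ℂ) r, ∀ w ∈ Metric.ball (0 : ℂ) r,
        (z, w) ∈ Metric.ball (0 : ℂ × ℂ) r := by
      intro z hz w hw
      rw [← Prod.mk_zero_zero, ← ball_prod_same]
      exact ⟨hz, hw⟩
    have h0r := Metric.mem_ball_self (x := (0 : ℂ)) hr
    have hA : ∀ z ∈ Metric.ball (0 : ℂ) r, ∀ w ∈ Metric.ball (0 : ℂ) r,
        AnalyticAt ℂ (fun p : ℂ × ℂ => F p.1 p.2) (z, w) :=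
      fun z hz w hw => (hball _ (hB z hz w hw)).1
    have hreal : ∀ z ∈ Metric.ball (0 : ℂ) r, ∀ w ∈ Metric.ball (0 : ℂ) r,
        F z w = conj (F (conj w) (conj z)) :=
      fun z hz w hw => (hball _ (hB z hz w hw)).2.1
    have hne : ∀ z ∈ Metric.ball (0 : ℂ) r, ∀ w ∈ Metric.ball (0 : ℂ) r,
        pd1 (pd2 F) z w ≠ 0 := fun z hz w hw => (hball _ (hB z hz w hw)).2.2.1
    have hsep := fun z hz w hw => separated_of_log_levi_mixed_eq_zero (z := z) (w := w) hA hne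
      (fun z hz w hw => (hball _ (hB z hz w hw)).2.2.2) hz hw
    have hpd : ∀ w ∈ Metric.ball (0 : ℂ) r, pd1 F 0 w = conj (pd2 F (conj w) 0) := by
      intro w hw
      have he : (fun t => F t w) =ᶠ[𝓝 0] (conj ∘ (fun t => F (conj w) t) ∘ conj) := by
        filter_upwards [Metric.isOpen_ball.mem_nhds h0r] with t ht using hreal t ht w hw
      rw [pd1, he.deriv_eq, deriv_conj_conj, Function.comp_apply, Function.comp_apply, map_zero,
        pd2]
    have hcreal : conj (pd1 (pd2 F) 0 0) = pd1 (pd2 F) 0 0 := by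
      have he : (fun t => pd1 F 0 t) =ᶠ[𝓝 0] (conj ∘ (fun t => pd2 F t 0) ∘ conj) := by
        filter_upwards [Metric.isOpen_ball.mem_nhds h0r] with t ht using hpd t ht
      have hc : pd2 (pd1 F) 0 0 = conj (pd1 (pd2 F) 0 0) := by
        rw [pd2, he.deriv_eq, deriv_conj_conj, Function.comp_apply, Function.comp_apply,
          map_zero, pd1]
      rw [← hc, pd2_pd1_comm (hA 0 h0r 0 h0r)]
    obtain ⟨ρ, hρ⟩ := Complex.conj_eq_iff_real.1 hcreal
    have hslot : ∀ {K : ℂ → ℂ → ℂ}, AnalyticAt ℂ (fun p : ℂ × ℂ => K p.1 p.2) (0, 0) →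
        AnalyticAt ℂ (fun z => K z 0) 0 := fun hK =>
      hK.comp_of_eq (f := fun z : ℂ => (z, (0 : ℂ))) (analyticAt_id.prod analyticAt_const) rfl
    refine ⟨ρ, ?_, fun z => pd2 F z 0 - pd2 F 0 0, fun z => -2 * ρ * F z 0, ?_, ?_, sub_self _,
      ?_, ?_⟩
    · rintro rfl
      exact hne 0 h0r 0 h0r (by simpa using hρ)
    · exact (hslot (analyticAt_pd2 (hA 0 h0r 0 h0r))).sub analyticAt_const
    · exact analyticAt_const.mul (hslot (hA 0 h0r 0 h0r))
    · rw [deriv_sub_const]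
      exact hne 0 h0r 0 h0r
    · filter_upwards [Metric.ball_mem_nhds (0 : ℂ × ℂ) hr] with p hp
      rw [← Prod.mk_zero_zero, ← ball_prod_same] at hp
      have h1 := hsep p.1 hp.1 p.2 hp.2
      have h2 := hreal 0 h0r p.2 hp.2
      rw [hpd p.2 hp.2, hpd 0 h0r, hρ, hF0] at h1
      rw [map_zero] at h1 h2
      simp only [map_sub, map_mul, map_neg, Complex.conj_ofReal, map_ofNat]
      rw [← h2]
      linear_combination h1
  · rintro ⟨ρ, hρ, f, g, hf, hg, -, -, h⟩
    have hρ' : (ρ : ℂ) ≠ 0 := Complex.ofReal_ne_zero.2 hρ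
    refine invariant_eq_zero_of_separated (f := fun z => (ρ : ℂ)⁻¹ * f z)
      (h := fun w => conj (f (conj w))) (a := fun z => -(ρ : ℂ)⁻¹ * (1 / 2) * g z)
      (b := fun w => -(ρ : ℂ)⁻¹ * (1 / 2) * conj (g (conj w)))
      (analyticAt_const.mul hf) (hconjA hf) (analyticAt_const.mul (hconjA hg)) ?_
    filter_upwards [h] with p hp
    field_simp
    linear_combination 2 * hp
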